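/- arXiv:2403.14024 — 4 statements merged into one kernel-verified Lean document; each statement's English description precedes it below -/
import Mathlib

section
/- For all integers d ≥ 1 and α ≥ 1, the expectation over a uniformly random permutation σ ∈ S_d of the quantity ∑_{O} ⌈|O|/α⌉, the sum running over all orbits O of σ on {1,…,d}, satisfies (1/d!) · ∑_{σ ∈ S_d} ∑_{O orbit of σ} ⌈|O|/α⌉ < d/α + H_d. -/
open scoped Classical

namespace Equiv.Perm

/-- A map which sends every `σ`-step into a `τ`-cycle sends `σ`-cycles into `τ`-cycles. -/
theorem SameCycle.map_of_step {α β : Type*} {σ : Perm α} {τ : Perm β} {g : α → β}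
    (h : ∀ z, SameCycle τ (g z) (g (σ z))) {x y : α} (hxy : SameCycle σ x y) :
    SameCycle τ (g x) (g y) := by
  obtain ⟨i, rfl⟩ := hxy
  induction i with
  | zero => exact SameCycle.refl _ _
  | succ i ih =>
    rw [add_comm, zpow_add, zpow_one, mul_apply]
    exact ih.trans (h _)
  | pred i ih =>
    refine ih.trans ?_
    have := (h ((σ ^ (-(i : ℤ) - 1)) x)).symm
    rwa [← mul_apply, ← zpow_one_add, add_sub_cancel] at this

theorem orbitRel_zpowers_iff {α : Type*} {σ : Perm α} {x y : α} :
    MulAction.orbitRel (Subgroup.zpowers σ) α x y ↔ SameCycle σ x y := by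
  rw [MulAction.orbitRel_apply, sameCycle_comm]
  constructor
  · rintro ⟨⟨_, i, rfl⟩, h⟩
    exact ⟨i, h⟩
  · rintro ⟨i, h⟩
    exact ⟨⟨_, i, rfl⟩, h⟩

/-- The orbits of a permutation. -/
abbrev Orbits {α : Type*} (σ : Perm α) : Type _ :=
  MulAction.orbitRel.Quotient (Subgroup.zpowers σ) α

/-- Adding a fixed point to a permutation adds one orbit. -/
theorem card_orbits_decomposeFin_symm_zero {n : ℕ} (e : Perm (Fin n)) :
    Nat.card (Orbits (decomposeFin.symm (0, e))) = Nat.card (Orbits e) + 1 := by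
  set σ := decomposeFin.symm (0, e) with hσ
  have h_zero : σ 0 = 0 := by simp [hσ]
  have h_succ : ∀ x : Fin n, σ x.succ = (e x).succ := by simp [hσ]
  rw [← Finite.card_option]
  let g : Fin (n + 1) → Option (Orbits e) :=
    Fin.cases none fun x => some (Quotient.mk _ x)
  have hg : ∀ z, g (σ z) = g z := by
    refine Fin.cases (by rw [h_zero]) fun x => ?_
    rw [h_succ]
    exact congrArg some (Quotient.sound
      (orbitRel_zpowers_iff.2 (sameCycle_apply_left.2 (SameCycle.refl _ _))))
  refine Nat.card_congr
    { toFun := Quotient.lift g fun x y hxy => ?_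
      invFun := fun o => o.elim (Quotient.mk _ 0)
        (Quotient.map Fin.succ fun x y hxy => ?_)
      left_inv := ?_
      right_inv := ?_ }
  · have := SameCycle.map_of_step (τ := (1 : Perm (Option (Orbits e)))) (g := g)
      (fun z => by rw [hg]) (orbitRel_zpowers_iff.1 hxy)
    simpa using this
  · exact orbitRel_zpowers_iff.2 (SameCycle.map_of_step
      (fun z => by rw [← h_succ]; exact sameCycle_apply_right.2 (SameCycle.refl _ _))
      (orbitRel_zpowers_iff.1 hxy))
  · rintro ⟨z⟩
    induction z using Fin.cases <;> rfl
  · rintro (_ | ⟨⟨x⟩⟩) <;> rfl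

/-- Inserting a point into an existing cycle does not change the number of orbits. -/
theorem card_orbits_decomposeFin_symm_succ {n : ℕ} (a : Fin n) (e : Perm (Fin n)) :
    Nat.card (Orbits (decomposeFin.symm (a.succ, e))) = Nat.card (Orbits e) := by
  set σ := decomposeFin.symm (a.succ, e) with hσ
  have h_zero : σ 0 = a.succ := by simp [hσ]
  have h_cut : ∀ x, e x = a → σ x.succ = 0 := by
    rintro x hx
    simp [hσ, decomposeFin_symm_apply_succ, hx]
  have h_succ : ∀ x, e x ≠ a → σ x.succ = (e x).succ := by
    intro x hx
    rw [hσ, decomposeFin_symm_apply_succ,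
      swap_apply_of_ne_of_ne (Fin.succ_ne_zero _) (by simpa using hx)]
  let g : Fin (n + 1) → Fin n := Fin.cases a id
  have hg : ∀ z, SameCycle e (g z) (g (σ z)) := by
    refine Fin.cases (by rw [h_zero]; exact SameCycle.refl _ _) fun x => ?_
    have : g (σ x.succ) = e x := by
      by_cases hx : e x = a
      · rw [h_cut x hx, hx]; rfl
      · rw [h_succ x hx]; rfl
    rw [this]
    exact sameCycle_apply_right.2 (SameCycle.refl _ _)
  have hs : ∀ x : Fin n, SameCycle σ x.succ (e x).succ := by
    intro x
    by_cases hx : e x = a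
    · rw [hx, ← h_zero, ← h_cut x hx]
      exact sameCycle_apply_right.2 (sameCycle_apply_right.2 (SameCycle.refl _ _))
    · rw [← h_succ x hx]
      exact sameCycle_apply_right.2 (SameCycle.refl _ _)
  refine Nat.card_congr
    { toFun := Quotient.map g fun x y hxy =>
        orbitRel_zpowers_iff.2 (SameCycle.map_of_step hg (orbitRel_zpowers_iff.1 hxy))
      invFun := Quotient.map Fin.succ fun x y hxy =>
        orbitRel_zpowers_iff.2 (SameCycle.map_of_step hs (orbitRel_zpowers_iff.1 hxy))
      left_inv := ?_
      right_inv := ?_ }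
  · rintro ⟨z⟩
    refine Quotient.sound (orbitRel_zpowers_iff.2 ?_)
    induction z using Fin.cases with
    | zero =>
      change SameCycle σ a.succ 0
      rw [← h_zero]
      exact sameCycle_apply_left.2 (SameCycle.refl _ _)
    | succ x => exact SameCycle.refl _ _
  · rintro ⟨x⟩
    rfl

/-- The expected number of orbits of a random permutation is a harmonic number. -/
theorem sum_card_orbits (n : ℕ) :
    ∑ σ : Perm (Fin n), (Nat.card (Orbits σ) : ℚ)
      = n.factorial * ∑ i ∈ Finset.Icc 1 n, (1 : ℚ) / i := by
  induction n with
  | zero => simp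
  | succ n ih =>
    rw [← decomposeFin.symm.sum_comp, Fintype.sum_prod_type, Fin.sum_univ_succ]
    simp only [card_orbits_decomposeFin_symm_zero, card_orbits_decomposeFin_symm_succ]
    push_cast
    rw [Finset.sum_add_distrib, ih, Finset.sum_Icc_succ_top (by omega), Nat.factorial_succ]
    simp only [Finset.sum_const, Finset.card_univ, Fintype.card_perm, Fintype.card_fin,
      nsmul_eq_mul]
    push_cast
    field_simp
    ring

theorem sum_card_orbit {n : ℕ} (σ : Perm (Fin n)) :
    ∑ O : Orbits σ, (Nat.card O.orbit : ℚ) = n := by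
  have := Nat.card_congr (MulAction.selfEquivSigmaOrbits' (Subgroup.zpowers σ) (Fin n))
  rw [Nat.card_sigma, Nat.card_fin] at this
  exact_mod_cast this.symm

theorem sum_ceil_card_orbit_lt {d : ℕ} (hd : 1 ≤ d) (α : ℚ) (σ : Perm (Fin d)) :
    ∑ O : Orbits σ, (⌈(Nat.card O.orbit : ℚ) / α⌉ : ℚ) < d / α + Nat.card (Orbits σ) := by
  have : Nonempty (Orbits σ) := ⟨Quotient.mk _ ⟨0, hd⟩⟩
  calc ∑ O : Orbits σ, (⌈(Nat.card O.orbit : ℚ) / α⌉ : ℚ)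
      < ∑ O : Orbits σ, ((Nat.card O.orbit : ℚ) / α + 1) :=
        Finset.sum_lt_sum_of_nonempty Finset.univ_nonempty fun O _ => Int.ceil_lt_add_one _
    _ = d / α + Nat.card (Orbits σ) := by
        rw [Finset.sum_add_distrib, ← Finset.sum_div, sum_card_orbit]
        simp [Nat.card_eq_fintype_card]

end Equiv.Perm

/-- For `d ≥ 1` and `α ≥ 1`, the expectation over a uniformly random permutation
`σ ∈ S_d` of `∑_O ⌈|O|/α⌉`, the sum over all orbits `O` of the cyclic subgroup
generated by `σ` acting on `{1,…,d}`, is less than `d/α + H_d`. -/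
theorem expected_typeV_storage_lt (d α : ℕ) (hd : 1 ≤ d) (hα : 1 ≤ α) :
    (1 / (Nat.factorial d : ℚ)) *
      ∑ σ : Equiv.Perm (Fin d),
        ∑ O : MulAction.orbitRel.Quotient (Subgroup.zpowers σ) (Fin d),
          (⌈(Nat.card O.orbit : ℚ) / (α : ℚ)⌉ : ℚ)
      < (d : ℚ) / (α : ℚ) + ∑ i ∈ Finset.Icc 1 d, (1 : ℚ) / (i : ℚ) := by
  have h_pos : (0 : ℚ) < d.factorial := by exact_mod_cast d.factorial_pos
  rw [one_div_mul_eq_div, div_lt_iff₀' h_pos]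
  refine (Finset.sum_lt_sum_of_nonempty Finset.univ_nonempty fun σ _ =>
    Equiv.Perm.sum_ceil_card_orbit_lt hd α σ).trans_eq ?_
  rw [Finset.sum_add_distrib, Equiv.Perm.sum_card_orbits, mul_add]
  simp [Fintype.card_perm]
end

section
/- Let p_d be the probability that two permutations σ₀, σ₁ drawn independently and uniformly at random from S_d generate a subgroup whose action on {1,…,d} is transitive, i.e. p_d = |{(σ₀,σ₁) ∈ S_d × S_d : the subgroup generated by σ₀ and σ₁ acts transitively on {1,…,d}}| / (d!)². Then p_d = 1 − d^{−1} + O(d^{−2}) as d → ∞; that is, the function d ↦ p_d − (1 − 1/d) is O(1/d²) at infinity. -/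
/-- The probability that two independent uniformly random permutations of `{1,…,d}`
generate a transitive subgroup of `S_d`. -/
noncomputable def transitivePairProb (d : ℕ) : ℝ :=
  (Nat.card {x : Equiv.Perm (Fin d) × Equiv.Perm (Fin d) //
      MulAction.IsPretransitive (Subgroup.closure {x.1, x.2}) (Fin d)} : ℝ) /
    ((Nat.factorial d : ℝ)) ^ 2

open MulAction Finset
open scoped Pointwise

section InvariantSets

variable {α : Type*} [Fintype α] [DecidableEq α]

/-- The orbit-stabilizer theorem for the action of the symmetric group on finite subsets. -/
theorem choose_mul_card_stabilizer_perm (s : Finset α) :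
    (Fintype.card α).choose #s * Nat.card (stabilizer (Equiv.Perm α) s) =
      (Fintype.card α).factorial := by
  have := Set.powersetCard.isPretransitive (α := α) (n := #s)
  let t : Set.powersetCard α #s := ⟨s, rfl⟩
  have ht : stabilizer (Equiv.Perm α) t = stabilizer (Equiv.Perm α) s := by
    ext g
    rw [mem_stabilizer_iff, mem_stabilizer_iff, Subtype.ext_iff, Set.powersetCard.coe_smul]
  have hi := index_stabilizer_of_transitive (Equiv.Perm α) t
  rw [ht, Set.powersetCard.card, Nat.card_eq_fintype_card] at hi
  rw [← hi, Subgroup.index_mul_card, Nat.card_eq_fintype_card, Fintype.card_perm]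

open Classical in
/-- The pairs of permutations that both preserve `s`. -/
noncomputable def invariantPairs (s : Finset α) : Finset (Equiv.Perm α × Equiv.Perm α) :=
  {x | x.1 ∈ stabilizer (Equiv.Perm α) s ∧ x.2 ∈ stabilizer (Equiv.Perm α) s}

open Classical in
/-- The pairs of permutations that generate an intransitive group. -/
noncomputable def intransitivePairs (α : Type*) [Fintype α] [DecidableEq α] :
    Finset (Equiv.Perm α × Equiv.Perm α) :=
  {x | ¬ IsPretransitive (Subgroup.closure {x.1, x.2}) α}

theorem mem_invariantPairs {s : Finset α} {x : Equiv.Perm α × Equiv.Perm α} :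
    x ∈ invariantPairs s ↔ Subgroup.closure {x.1, x.2} ≤ stabilizer (Equiv.Perm α) s := by
  simp [invariantPairs, Subgroup.closure_le, Set.insert_subset_iff]

theorem card_invariantPairs (s : Finset α) :
    (#(invariantPairs s) : ℝ) =
      (Fintype.card α).factorial ^ 2 * (1 / ((Fintype.card α).choose #s : ℝ) ^ 2) := by
  classical
  have h : #(invariantPairs s) = Nat.card (stabilizer (Equiv.Perm α) s) ^ 2 := by
    rw [invariantPairs, ← univ_product_univ,
      filter_product (· ∈ stabilizer (Equiv.Perm α) s) (· ∈ stabilizer (Equiv.Perm α) s),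
      card_product, ← sq, Nat.card_eq_fintype_card, Fintype.card_subtype]
  have hpos : ((Fintype.card α).choose #s : ℝ) ≠ 0 := by
    exact_mod_cast (Nat.choose_pos (card_le_univ s)).ne'
  rw [h, ← choose_mul_card_stabilizer_perm s]
  push_cast
  field_simp

/-- An intransitive group has an invariant set of at most half the size. -/
theorem intransitivePairs_subset :
    intransitivePairs α ⊆
      ({s : Finset α | 0 < #s ∧ 2 * #s ≤ Fintype.card α} : Finset _).biUnion invariantPairs := by
  classical
  intro x hx
  have hx : ¬ IsPretransitive (Subgroup.closure {x.1, x.2}) α := by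
    simpa [intransitivePairs] using hx
  set G := Subgroup.closure {x.1, x.2}
  obtain ⟨a, b, hab⟩ : ∃ a b : α, ∀ g : G, g • a ≠ b := by
    by_contra! h
    exact hx ⟨h⟩
  let s : Finset α := {c | c ∈ orbit G a}
  have ha : a ∈ s := by simp [s]
  have hb : b ∈ sᶜ := by
    simp only [s, mem_compl, mem_filter, mem_univ, true_and, mem_orbit_iff, not_exists]
    exact hab
  have hs : G ≤ stabilizer (Equiv.Perm α) s := by
    intro g hg
    rw [mem_stabilizer_finset]
    intro c
    simp only [s, mem_filter, mem_univ, true_and]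
    rw [← orbit_eq_iff, ← orbit_eq_iff, ← orbit_smul (⟨g, hg⟩ : G) c]
    rfl
  have hsc : G ≤ stabilizer (Equiv.Perm α) sᶜ := by
    intro g hg
    have := hs hg
    rw [mem_stabilizer_finset] at this ⊢
    intro c
    rw [mem_compl, mem_compl, this c]
  have hcard := card_add_card_compl s
  simp only [mem_biUnion, mem_filter, mem_univ, true_and, mem_invariantPairs]
  rcases le_total #s #sᶜ with h | h
  · exact ⟨s, ⟨card_pos.2 ⟨a, ha⟩, by omega⟩, hs⟩
  · exact ⟨sᶜ, ⟨card_pos.2 ⟨b, hb⟩, by omega⟩, hsc⟩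

theorem card_intransitivePairs_le :
    (#(intransitivePairs α) : ℝ) ≤ (Fintype.card α).factorial ^ 2 *
      ∑ k ∈ range (Fintype.card α + 1),
        if 0 < k ∧ 2 * k ≤ Fintype.card α then 1 / ((Fintype.card α).choose k : ℝ) else 0 := by
  have h := (card_le_card (intransitivePairs_subset (α := α))).trans card_biUnion_le
  have h' : (#(intransitivePairs α) : ℝ) ≤
      ∑ s : Finset α with 0 < #s ∧ 2 * #s ≤ Fintype.card α, (#(invariantPairs s) : ℝ) := by
    exact_mod_cast h
  refine h'.trans (le_of_eq ?_)
  simp_rw [card_invariantPairs]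
  rw [← mul_sum, sum_filter, ← powerset_univ,
    sum_powerset_apply_card (fun k => if 0 < k ∧ 2 * k ≤ Fintype.card α then
      1 / ((Fintype.card α).choose k : ℝ) ^ 2 else 0), card_univ]
  congr 1
  refine sum_congr rfl fun k hk => ?_
  have hpos : ((Fintype.card α).choose k : ℝ) ≠ 0 := by
    exact_mod_cast (Nat.choose_pos (by simpa [Nat.lt_succ_iff] using hk)).ne'
  split_ifs
  · rw [nsmul_eq_mul]
    field_simp
  · simp

/-- The Bonferroni inequality for the number of common fixed points. -/
theorem sum_card_invariantPairs_singleton_le [Nontrivial α] :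
    ∑ i : α, #(invariantPairs {i}) ≤
      #(intransitivePairs α) +
        ∑ p ∈ (univ : Finset α).offDiag, #(invariantPairs {p.1, p.2}) := by
  classical
  have count {ι : Type _} (t : Finset ι) (f : ι → Finset (Equiv.Perm α × Equiv.Perm α)) :
      ∑ i ∈ t, #(f i) = ∑ x, #{i ∈ t | x ∈ f i} := by
    simp_rw [card_eq_sum_ones, sum_filter]
    rw [sum_comm]
    simp
  have hN : #(intransitivePairs α) = ∑ x, if x ∈ intransitivePairs α then 1 else 0 := by
    simp
  rw [count, count, hN, ← sum_add_distrib]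
  refine sum_le_sum fun x _ => ?_
  set F : Finset α := {i | x ∈ invariantPairs {i}} with hF
  have hsub : F.offDiag ⊆
      ({p ∈ (univ : Finset α).offDiag | x ∈ invariantPairs {p.1, p.2}} : Finset _) := by
    intro p hp
    simp only [hF, mem_offDiag, mem_filter, mem_univ, true_and, mem_invariantPairs] at hp ⊢
    refine ⟨hp.2.2, fun g hg => ?_⟩
    have h1 := hp.1 hg
    have h2 := hp.2.1 hg
    rw [mem_stabilizer_iff] at h1 h2 ⊢
    rw [insert_eq, smul_finset_union, h1, h2]
  have hcard := card_le_card hsub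
  rw [offDiag_card] at hcard
  rcases F.eq_empty_or_nonempty with h0 | ⟨i, hi⟩
  · simp [h0]
  · have hx : x ∈ intransitivePairs α := by
      simp only [intransitivePairs, mem_filter, mem_univ, true_and]
      intro ht
      obtain ⟨j, hj⟩ := exists_ne i
      obtain ⟨g, hg⟩ := ht.exists_smul_eq i j
      have hi' : x ∈ invariantPairs {i} := by simpa [hF] using hi
      have := mem_invariantPairs.1 hi' g.2
      rw [mem_stabilizer_iff, smul_finset_singleton, singleton_inj] at this
      exact hj (hg.symm.trans this)
    rw [if_pos hx]
    have hpos : 0 < #F := card_pos.2 ⟨i, hi⟩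
    obtain ⟨m, hm⟩ : ∃ m, #F = m + 1 := ⟨#F - 1, by omega⟩
    rw [hm] at hcard ⊢
    have : (m + 1) * (m + 1) - (m + 1) = m * m + m := by
      rw [Nat.sub_eq_iff_eq_add (by nlinarith)]
      ring
    nlinarith

theorem le_card_intransitivePairs (h : 2 ≤ Fintype.card α) :
    ((Fintype.card α).factorial ^ 2 : ℝ) *
        (1 / Fintype.card α - 4 / (Fintype.card α * (Fintype.card α - 1))) ≤
      #(intransitivePairs α) := by
  have : Nontrivial α := Fintype.one_lt_card_iff_nontrivial.1 h
  have key : (∑ i : α, (#(invariantPairs {i}) : ℝ)) ≤ #(intransitivePairs α) +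
      ∑ p ∈ (univ : Finset α).offDiag, (#(invariantPairs {p.1, p.2}) : ℝ) := by
    exact_mod_cast sum_card_invariantPairs_singleton_le (α := α)
  have hpair : ∑ p ∈ (univ : Finset α).offDiag, (#(invariantPairs {p.1, p.2}) : ℝ) =
      ∑ p ∈ (univ : Finset α).offDiag,
        (Fintype.card α).factorial ^ 2 * (1 / ((Fintype.card α).choose 2 : ℝ) ^ 2) := by
    refine sum_congr rfl fun p hp => ?_
    rw [card_invariantPairs, card_pair (mem_offDiag.1 hp).2.2]
  have hoff : (#(univ : Finset α).offDiag : ℝ) = Fintype.card α * (Fintype.card α - 1) := by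
    rw [offDiag_card, card_univ, Nat.cast_sub (Nat.le_mul_self _)]
    push_cast
    ring
  have h2 : (2 : ℝ) ≤ Fintype.card α := by exact_mod_cast h
  rw [hpair, sum_const, nsmul_eq_mul, hoff, Nat.cast_choose_two] at key
  simp_rw [card_invariantPairs, card_singleton, Nat.choose_one_right] at key
  rw [sum_const, nsmul_eq_mul, card_univ] at key
  have hd : (Fintype.card α : ℝ) ≠ 0 := by linarith
  have hd1 : (Fintype.card α : ℝ) - 1 ≠ 0 := by linarith
  refine le_trans (le_of_eq ?_) (sub_le_iff_le_add.2 key)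
  field_simp
  norm_num

end InvariantSets

theorem Nat.choose_three_le_choose {n k : ℕ} (hk : 3 ≤ k) (hkn : 2 * k ≤ n) :
    n.choose 3 ≤ n.choose k := by
  induction k, hk using Nat.le_induction with
  | base => rfl
  | succ k _ ih => exact (ih (by omega)).trans (Nat.choose_le_succ_of_lt_half_left (by omega))

theorem sum_inv_choose_le {d : ℕ} (hd : 6 ≤ d) :
    (∑ k ∈ range (d + 1), if 0 < k ∧ 2 * k ≤ d then 1 / (d.choose k : ℝ) else 0) ≤
      1 / d + 52 / (d : ℝ) ^ 2 := by
  have hd' : (6 : ℝ) ≤ d := by exact_mod_cast hd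
  have h3 : (d.choose 3 : ℝ) = d * (d - 1) * (d - 2) / 6 := by
    rw [Nat.cast_choose_eq_ascPochhammer_div]
    have : ((d - (3 - 1) : ℕ) : ℝ) = d - 2 := by
      rw [Nat.cast_sub (by omega)]
      norm_num
    rw [this]
    simp [ascPochhammer_succ_right, Nat.factorial]
    ring
  have hle : ∀ k ∈ range (d + 1),
      (if 0 < k ∧ 2 * k ≤ d then 1 / (d.choose k : ℝ) else 0) ≤
        (if k = 1 then 1 / (d : ℝ) else 0) + (if k = 2 then 1 / (d.choose 2 : ℝ) else 0) +
          1 / (d.choose 3 : ℝ) := by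
    intro k _
    have hnonneg : 0 ≤ 1 / (d.choose 3 : ℝ) := by positivity
    rcases Nat.lt_or_ge k 3 with hk | hk
    · interval_cases k
      · simp
      · simp [show 2 ≤ d by omega]
      · simp [show 4 ≤ d by omega]
    · have hpos : 0 < d.choose 3 := Nat.choose_pos (by omega)
      rw [if_neg (show k ≠ 1 by omega), if_neg (show k ≠ 2 by omega), zero_add, zero_add]
      split_ifs with h
      · exact one_div_le_one_div_of_le (by exact_mod_cast hpos)
          (by exact_mod_cast Nat.choose_three_le_choose hk h.2)
      · exact hnonneg
  refine (sum_le_sum hle).trans ?_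
  rw [sum_add_distrib, sum_add_distrib, sum_ite_eq', sum_ite_eq', sum_const, card_range,
    if_pos (by simp; omega), if_pos (by simp; omega), nsmul_eq_mul, h3, Nat.cast_choose_two]
  have e2 : 1 / ((d : ℝ) * (d - 1) / 2) ≤ 4 / (d : ℝ) ^ 2 := by
    rw [div_le_div_iff₀ (by nlinarith) (by positivity)]
    nlinarith
  have e3 : ((d + 1 : ℕ) : ℝ) * (1 / ((d : ℝ) * (d - 1) * (d - 2) / 6)) ≤ 48 / (d : ℝ) ^ 2 := by
    have h1 : (0 : ℝ) < d - 1 := by linarith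
    have h2 : (0 : ℝ) < d - 2 := by linarith
    push_cast
    rw [mul_one_div, div_le_div_iff₀ (by positivity) (by positivity)]
    have : ((d : ℝ) + 1) * d ≤ 8 * ((d - 1) * (d - 2)) := by nlinarith
    nlinarith [mul_le_mul_of_nonneg_left this (show (0 : ℝ) ≤ d by linarith)]
  have : (52 : ℝ) / (d : ℝ) ^ 2 = 4 / (d : ℝ) ^ 2 + 48 / (d : ℝ) ^ 2 := by ring
  linarith

theorem transitivePairProb_eq (d : ℕ) :
    transitivePairProb d = 1 - #(intransitivePairs (Fin d)) / (d.factorial : ℝ) ^ 2 := by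
  classical
  have h := card_filter_add_card_filter_not (s := univ)
    (fun x : Equiv.Perm (Fin d) × Equiv.Perm (Fin d) =>
      IsPretransitive (Subgroup.closure {x.1, x.2}) (Fin d))
  rw [card_univ, Fintype.card_prod, Fintype.card_perm, Fintype.card_fin] at h
  have h' : (#(univ.filter fun x : Equiv.Perm (Fin d) × Equiv.Perm (Fin d) =>
      IsPretransitive (Subgroup.closure {x.1, x.2}) (Fin d)) : ℝ) +
        #(intransitivePairs (Fin d)) = (d.factorial : ℝ) ^ 2 := by
    rw [sq]
    unfold intransitivePairs
    exact_mod_cast h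
  have hpos : (d.factorial : ℝ) ≠ 0 := by exact_mod_cast d.factorial_ne_zero
  rw [transitivePairProb, Nat.card_eq_fintype_card, Fintype.card_subtype, eq_sub_iff_add_eq,
    ← add_div, h', div_self (pow_ne_zero 2 hpos)]

/-- Dixon's theorem: the probability `p_d` that two uniformly random permutations of
`{1,…,d}` generate a transitive subgroup satisfies `p_d = 1 − d⁻¹ + O(d⁻²)` as `d → ∞`. -/
theorem dixon_transitive_prob :
    (fun d : ℕ => transitivePairProb d - (1 - 1 / (d : ℝ))) =O[Filter.atTop]
      fun d : ℕ => 1 / (d : ℝ) ^ 2 := by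
  refine Asymptotics.IsBigO.of_bound 52 ?_
  filter_upwards [Filter.eventually_ge_atTop 6] with d hd
  have hd' : (6 : ℝ) ≤ d := by exact_mod_cast hd
  have hF : (0 : ℝ) < (d.factorial : ℝ) ^ 2 := by positivity
  have upper := card_intransitivePairs_le (α := Fin d)
  have lower := le_card_intransitivePairs (α := Fin d) (by simp; omega)
  rw [Fintype.card_fin] at upper lower
  rw [mul_comm, ← le_div_iff₀ hF] at lower
  rw [mul_comm, ← div_le_iff₀ hF] at upper
  have hsum := sum_inv_choose_le hd
  have hsmall : 4 / ((d : ℝ) * (d - 1)) ≤ 52 / (d : ℝ) ^ 2 := by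
    rw [div_le_div_iff₀ (by nlinarith) (by positivity)]
    nlinarith
  rw [transitivePairProb_eq, Real.norm_eq_abs, Real.norm_of_nonneg (by positivity), mul_one_div,
    abs_le]
  constructor <;> linarith
end

section
/- Suppose the subgroup of permutations generated by σ₀ and σ₁ acts transitively on Ω. Then the monodromy solving process never gets stuck (whenever the list S is a proper subset of Ω and all elements of the current cycle of σ₀ have been found, there exists an already-found solution s_j, with index j at least the current pointer value, such that σ₁(s_j) ∉ S) and the process terminates with S containing every element of Ω exactly once. -/
/-- State of the monodromy solving process (Algorithm 1): the ordered list `S` of found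
solutions, the scan pointer `ptr` (0-based index into `S`), the list `F` of founder
indices (1-based), and the numbers `n0`, `n1` of oracle queries to `σ₀`, `σ₁` so far. -/
structure MonoState (Ω : Type*) where
  S : List Ω
  ptr : ℕ
  F : List ℕ
  n0 : ℕ
  n1 : ℕ

variable {Ω : Type*} [DecidableEq Ω]

/-- The scan of the inner while-loop: the first index `i ≥ ptr` with `σ₁ S[i] ∉ S`. -/
def monoScan (σ₁ : Equiv.Perm Ω) (S : List Ω) (ptr : ℕ) (dflt : Ω) : Option ℕ :=
  ((List.range S.length).drop ptr).find? fun i => σ₁ (S.getD i dflt) ∉ S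

/-- One iteration of the outer while-loop of the monodromy solving process: apply `σ₀` to
the last found solution; if the result is new, append it; otherwise scan with `σ₁` from
the pointer for a new solution (recording the founder index), failing if the scan finds
none. Oracle queries to `σ₀` and `σ₁` are counted by `n0` and `n1`. -/
def monoStep (σ₀ σ₁ : Equiv.Perm Ω) (dflt : Ω) (st : MonoState Ω) : Option (MonoState Ω) :=
  let q := σ₀ (st.S.getLastD dflt)
  if q ∉ st.S then
    some { st with S := st.S ++ [q], n0 := st.n0 + 1 }
  else
    match monoScan σ₁ st.S st.ptr dflt with
    | none => none
    | some i =>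
        some { S := st.S ++ [σ₁ (st.S.getD i dflt)], ptr := i + 1, F := st.F ++ [i + 1],
               n0 := st.n0 + 1, n1 := st.n1 + (i + 1 - st.ptr) }

/-- Running `k` iterations of the monodromy solving process started from the seed
solution `s₁` (so `S = [s₁]`, pointer `1` (0-based `0`), no founder indices, no queries);
`none` means the process got stuck. -/
def monoRun (σ₀ σ₁ : Equiv.Perm Ω) (s₁ : Ω) (k : ℕ) : Option (MonoState Ω) :=
  (fun o => o.bind (monoStep σ₀ σ₁ s₁))^[k] (some ⟨[s₁], 0, [], 0, 0⟩)

/-- A list closed under two permutations that generate a transitive group is empty or contains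
every element. -/
theorem mem_of_closed_of_isPretransitive {Ω : Type*} [DecidableEq Ω] {σ₀ σ₁ : Equiv.Perm Ω}
    (htrans : MulAction.IsPretransitive (Subgroup.closure {σ₀, σ₁} : Subgroup (Equiv.Perm Ω)) Ω)
    {S : List Ω} {s : Ω} (hs : s ∈ S) (h₀ : ∀ x ∈ S, σ₀ x ∈ S) (h₁ : ∀ x ∈ S, σ₁ x ∈ S) (x : Ω) :
    x ∈ S := by
  have key : ∀ g ∈ Subgroup.closure {σ₀, σ₁}, ∀ y ∈ S, g y ∈ S := by
    intro g hg
    induction hg using Subgroup.closure_induction with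
    | mem g hg =>
      rcases hg with rfl | rfl
      · exact h₀
      · exact h₁
    | one => simp
    | mul a b _ _ ha hb => exact fun y hy => ha _ (hb _ hy)
    | inv a _ ha =>
      intro y hy
      have himage : S.toFinset.image a = S.toFinset := by
        refine Finset.eq_of_subset_of_card_le (fun z hz => ?_)
          (Finset.card_image_of_injective _ a.injective).ge
        obtain ⟨w, hw, rfl⟩ := Finset.mem_image.mp hz
        simpa using ha w (by simpa using hw)
      have hy' : y ∈ S.toFinset.image a := by
        rw [himage]
        simpa using hy
      obtain ⟨w, hw, rfl⟩ := Finset.mem_image.mp hy'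
      simpa using hw
  obtain ⟨g, hg⟩ := htrans.exists_smul_eq s x
  rw [← hg]
  exact key g.1 g.2 s hs

/-- The invariant of the monodromy solving process: the found solutions are distinct, those
before the pointer have their `σ₁`-image found, and all but the last one have their `σ₀`-image
found. -/
structure MonoInvariant {Ω : Type*} (σ₀ σ₁ : Equiv.Perm Ω) (dflt : Ω) (st : MonoState Ω) :
    Prop where
  ne_nil : st.S ≠ []
  nodup : st.S.Nodup
  scanned : ∀ i < st.ptr, σ₁ (st.S.getD i dflt) ∈ st.S
  ptr_le : st.ptr ≤ st.S.length
  cycle : ∀ x ∈ st.S, σ₀ x ∈ st.S ∨ x = st.S.getLastD dflt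

theorem monoScan_eq_none_iff {Ω : Type*} [DecidableEq Ω] {σ₁ : Equiv.Perm Ω} {S : List Ω}
    {ptr : ℕ} {dflt : Ω} :
    monoScan σ₁ S ptr dflt = none ↔
      ∀ i, ptr ≤ i → i < S.length → σ₁ (S.getD i dflt) ∈ S := by
  simp only [monoScan, List.range_eq_range', List.drop_range', List.find?_eq_none,
    List.mem_range'_1, decide_eq_true_eq, not_not]
  constructor
  · exact fun h i hi hl => h i (by omega)
  · exact fun h i hi => h i (by omega) (by omega)

theorem monoScan_eq_some {Ω : Type*} [DecidableEq Ω] {σ₁ : Equiv.Perm Ω} {S : List Ω}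
    {ptr : ℕ} {dflt : Ω} {i : ℕ} (h : monoScan σ₁ S ptr dflt = some i) :
    ptr ≤ i ∧ i < S.length ∧ σ₁ (S.getD i dflt) ∉ S ∧
      ∀ j, ptr ≤ j → j < i → σ₁ (S.getD j dflt) ∈ S := by
  simp only [monoScan, List.range_eq_range', List.drop_range', List.find?_range'_eq_some,
    List.mem_range'_1, decide_eq_true_eq, Bool.not_eq_true', decide_eq_false_iff_not,
    not_not] at h
  obtain ⟨hn, hi, hj⟩ := h
  exact ⟨by omega, by omega, hn, fun j hpj hji => hj j (by omega) hji⟩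

/-- While some solution is missing, an iteration succeeds, finds exactly one new solution and
preserves the invariant. -/
theorem MonoInvariant.exists_monoStep {Ω : Type*} [Fintype Ω] [DecidableEq Ω]
    {σ₀ σ₁ : Equiv.Perm Ω} {dflt : Ω}
    (htrans : MulAction.IsPretransitive (Subgroup.closure {σ₀, σ₁} : Subgroup (Equiv.Perm Ω)) Ω)
    {st : MonoState Ω} (h : MonoInvariant σ₀ σ₁ dflt st) (hlt : st.S.length < Fintype.card Ω) :
    ∃ st', monoStep σ₀ σ₁ dflt st = some st' ∧ MonoInvariant σ₀ σ₁ dflt st' ∧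
      st'.S.length = st.S.length + 1 := by
  obtain ⟨hne, hnd, hsc, hple, hcyc⟩ := h
  have getD_append : ∀ (q : Ω) (i : ℕ), i < st.S.length →
      (st.S ++ [q]).getD i dflt = st.S.getD i dflt := fun q i hi =>
    List.getD_append _ _ _ _ hi
  by_cases hq : σ₀ (st.S.getLastD dflt) ∈ st.S
  · have hclosed : ∀ x ∈ st.S, σ₀ x ∈ st.S := by
      intro x hx
      rcases hcyc x hx with hx | rfl
      · exact hx
      · exact hq
    cases hscan : monoScan σ₁ st.S st.ptr dflt with
    | none =>
      rw [monoScan_eq_none_iff] at hscan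
      have hclosed₁ : ∀ x ∈ st.S, σ₁ x ∈ st.S := by
        intro x hx
        obtain ⟨i, hi, rfl⟩ := List.getElem_of_mem hx
        rw [← List.getD_eq_getElem _ dflt hi]
        by_cases hip : i < st.ptr
        · exact hsc i hip
        · exact hscan i (by omega) hi
      obtain ⟨s, hs⟩ := List.exists_mem_of_ne_nil _ hne
      have hall := mem_of_closed_of_isPretransitive htrans hs hclosed hclosed₁
      have hcard : st.S.toFinset = Finset.univ := by ext x; simp [hall x]
      have := List.toFinset_card_le st.S
      rw [hcard, Finset.card_univ] at this
      omega
    | some i =>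
      obtain ⟨hpi, hil, hnew, hbefore⟩ := monoScan_eq_some hscan
      refine ⟨_, by simp only [monoStep, hq, hscan, not_true_eq_false, if_false]; rfl,
        ⟨by simp, ?_, ?_, by simp; omega, ?_⟩, by simp⟩
      · simpa using hnd.concat hnew
      · intro j hj
        rw [getD_append _ _ (by simp only at hj; omega)]
        rcases Nat.lt_succ_iff_lt_or_eq.mp hj with hji | rfl
        · refine List.mem_append_left _ ?_
          by_cases hjp : j < st.ptr
          · exact hsc j hjp
          · exact hbefore j (by omega) hji
        · simp
      · intro x hx
        rcases List.mem_append.mp hx with hx | hx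
        · exact Or.inl (List.mem_append_left _ (hclosed x hx))
        · right
          simpa using hx
  · refine ⟨_, by simp only [monoStep, hq, not_false_eq_true, if_true]; rfl,
      ⟨by simp, ?_, ?_, by simp; omega, ?_⟩, by simp⟩
    · simpa using hnd.concat hq
    · intro j hj
      rw [getD_append _ _ (lt_of_lt_of_le hj hple)]
      exact List.mem_append_left _ (hsc j hj)
    · intro x hx
      rcases List.mem_append.mp hx with hx | hx
      · left
        rcases hcyc x hx with hx | rfl
        · exact List.mem_append_left _ hx
        · simp
      · right
        simpa using hx

theorem exists_monoRun_eq_some {Ω : Type*} [Fintype Ω] [DecidableEq Ω]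
    {σ₀ σ₁ : Equiv.Perm Ω} (s₁ : Ω)
    (htrans : MulAction.IsPretransitive (Subgroup.closure {σ₀, σ₁} : Subgroup (Equiv.Perm Ω)) Ω)
    (k : ℕ) (hk : k < Fintype.card Ω) :
    ∃ st, monoRun σ₀ σ₁ s₁ k = some st ∧ MonoInvariant σ₀ σ₁ s₁ st ∧ st.S.length = k + 1 := by
  induction k with
  | zero => exact ⟨_, rfl, ⟨by simp, by simp, by simp, by simp, by simp⟩, rfl⟩
  | succ k ih =>
    obtain ⟨st, hrun, hinv, hlen⟩ := ih (by omega)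
    obtain ⟨st', hstep, hinv', hlen'⟩ := hinv.exists_monoStep htrans (by omega)
    refine ⟨st', ?_, hinv', by omega⟩
    rw [monoRun, Function.iterate_succ_apply']
    rw [monoRun] at hrun
    rw [hrun]
    exact hstep

/-- If `⟨σ₀,σ₁⟩` acts transitively on `Ω`, the monodromy solving process never gets stuck
(every iteration, in particular every scan of the inner loop, succeeds, i.e. no
intermediate run returns `none`) and after `d − 1` iterations it terminates with the
list `S` containing every element of `Ω` exactly once. -/
theorem monodromySolve_terminates {Ω : Type*} [Fintype Ω] [DecidableEq Ω]
    (σ₀ σ₁ : Equiv.Perm Ω) (s₁ : Ω) (hd : 1 ≤ Fintype.card Ω)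
    (htrans : MulAction.IsPretransitive (Subgroup.closure {σ₀, σ₁} : Subgroup (Equiv.Perm Ω)) Ω) :
    (∀ k ≤ Fintype.card Ω - 1, monoRun σ₀ σ₁ s₁ k ≠ none) ∧
    ∃ final : MonoState Ω, monoRun σ₀ σ₁ s₁ (Fintype.card Ω - 1) = some final ∧
      final.S.Nodup ∧ (∀ x : Ω, x ∈ final.S) ∧ final.S.length = Fintype.card Ω := by
  refine ⟨fun k hk => ?_, ?_⟩
  · obtain ⟨st, hrun, -⟩ := exists_monoRun_eq_some s₁ htrans k (by omega)
    simp [hrun]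
  · obtain ⟨st, hrun, hinv, hlen⟩ :=
      exists_monoRun_eq_some s₁ htrans (Fintype.card Ω - 1) (by omega)
    have hcard : st.S.length = Fintype.card Ω := by omega
    refine ⟨st, hrun, hinv.nodup, fun x => ?_, hcard⟩
    have huniv : st.S.toFinset = Finset.univ := by
      rw [← Finset.card_eq_iff_eq_univ, List.toFinset_card_of_nodup hinv.nodup, hcard]
    rw [← List.mem_toFinset, huniv]
    exact Finset.mem_univ x
end

section
/- Let σ be a permutation of a finite set Ω, let α ≥ 1 be an integer, let c ∈ Ω, let m be the cardinality of the orbit O of c under the cyclic group generated by σ, and let C = { σ^{αk}(c) : 0 ≤ k ≤ ⌊(m−1)/α⌋ }. Then for every s ∈ O there exists an integer 0 ≤ t ≤ α − 1 such that σ^t(s) ∈ C; consequently, membership of s in the cycle of c can be decided by at most α − 1 applications of σ followed by membership tests in C. -/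
open Function in
theorem Equiv.Perm.card_sameCycle_eq_minimalPeriod {Ω : Type*} (σ : Equiv.Perm Ω) (c : Ω) :
    Nat.card {x : Ω // σ.SameCycle c x} = minimalPeriod σ c := by
  have h : {x : Ω | σ.SameCycle c x} = MulAction.orbit (Subgroup.zpowers σ) c := by
    ext x
    simp [MulAction.mem_orbit_iff, Equiv.Perm.SameCycle, Subgroup.smul_def]
  calc
    Nat.card {x : Ω // σ.SameCycle c x} = Nat.card (MulAction.orbit (Subgroup.zpowers σ) c) :=
      congrArg (fun S : Set Ω => Nat.card S) h
    _ = Nat.card (ZMod (minimalPeriod (σ • ·) c)) :=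
      Nat.card_congr (MulAction.orbitZPowersEquiv σ c)
    _ = minimalPeriod σ c := Nat.card_zmod _

open Function in
theorem Equiv.Perm.SameCycle.exists_pow_eq_of_lt_minimalPeriod {Ω : Type*} [Finite Ω]
    {σ : Equiv.Perm Ω} {c s : Ω} (h : σ.SameCycle c s) :
    ∃ i < minimalPeriod σ c, (σ ^ i) c = s := by
  obtain ⟨n, rfl⟩ := h.exists_nat_pow_eq
  have hp : 0 < minimalPeriod σ c :=
    minimalPeriod_pos_of_mem_periodicPts (σ.injective.mem_periodicPts c)
  refine ⟨n % minimalPeriod σ c, Nat.mod_lt _ hp, ?_⟩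
  simp only [← Equiv.Perm.iterate_eq_pow]
  exact iterate_mod_minimalPeriod_eq


/-- Correctness of `inNewCycle`: let `σ` be a permutation of a finite set `Ω`, `α ≥ 1`,
`c ∈ Ω`, let `m` be the cardinality of the orbit of `c` under the cyclic group generated
by `σ`, and let `C = {σ^{αk}(c) : 0 ≤ k ≤ ⌊(m−1)/α⌋}`. Then every element `s` of the
orbit of `c` reaches `C` after at most `α − 1` applications of `σ`: there is `t ≤ α − 1`
with `σ^t(s) ∈ C`. -/
theorem inNewCycle_correct {Ω : Type*} [Fintype Ω] [DecidableEq Ω]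
    (σ : Equiv.Perm Ω) (α : ℕ) (hα : 1 ≤ α) (c : Ω)
    (m : ℕ) (hm : m = Nat.card {x : Ω // σ.SameCycle c x}) :
    ∀ s : Ω, σ.SameCycle c s →
      ∃ t : ℕ, t ≤ α - 1 ∧
        (σ ^ t) s ∈ (Finset.range ((m - 1) / α + 1)).image fun k => (σ ^ (α * k)) c := by
  intro s hs
  rw [Equiv.Perm.card_sameCycle_eq_minimalPeriod] at hm
  obtain ⟨i, hi, rfl⟩ := hs.exists_pow_eq_of_lt_minimalPeriod
  rw [← hm] at hi
  have hper : (σ ^ m) c = c := by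
    rw [hm, ← Equiv.Perm.iterate_eq_pow]
    exact Function.iterate_minimalPeriod
  simp only [Finset.mem_image, Finset.mem_range, ← Equiv.Perm.mul_apply, ← pow_add]
  obtain ⟨k, hik, hki⟩ : ∃ k, i ≤ α * k ∧ α * k ≤ i + (α - 1) := by
    refine ⟨(i + (α - 1)) / α, ?_, Nat.mul_div_le _ _⟩
    have := Nat.lt_mul_div_succ (i + (α - 1)) hα
    rw [mul_add] at this
    omega
  by_cases hk : α * k < m
  · refine ⟨α * k - i, by omega, k, ?_, by rw [Nat.sub_add_cancel hik]⟩
    rw [Nat.lt_succ_iff, Nat.le_div_iff_mul_le hα, mul_comm]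
    omega
  · refine ⟨m - i, by omega, 0, Nat.succ_pos _, ?_⟩
    rw [Nat.sub_add_cancel hi.le, hper]
    simp
end
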